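/- Let k be even, n = 2k, and define f : Λ^k(ℝ^{2k}) → ℝ by f(ω) := ⟨e^1∧e^2∧⋯∧e^{2k}; ω∧ω⟩. Then f is both ext. one affine and int. one affine, but f is not affine. -/

import Mathlib

/-! Basic setup: `Λᵏ(ℝⁿ)` in coordinates with respect to the standard basis
`e^I`, `I` a strictly increasing multi-index (modeled as a `k`-element subset of
`Fin n`), together with the exterior product, interior product, inner product,
Hodge star, and the various notions of one-directional convexity/affinity. -/

/-- Increasing multi-indices of length `k` in `{1,…,n}`: `k`-element subsets of `Fin n`.
`Idx n k` plays the role of `T_k`. -/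
abbrev Idx (n k : ℕ) := {s : Finset (Fin n) // s.card = k}

/-- `Λᵏ(ℝⁿ)`, identified with its coordinates in the standard basis `e^I`. -/
abbrev Lam (n k : ℕ) := Idx n k → ℝ

/-- The sign `sgn(R,S)` defined by `e^{[R,S]} = sgn(R,S) e^R ∧ e^S` for disjoint
increasing multi-indices: `(-1)` to the number of inversions between `R` and `S`. -/
def msign {n : ℕ} (R S : Finset (Fin n)) : ℝ :=
  (-1 : ℝ) ^ (((R ×ˢ S).filter (fun p => p.2 < p.1)).card)

/-- The basis form `e^S` (of degree `k = S.card`; zero if `k ≠ S.card`). -/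
def bform {n k : ℕ} (S : Finset (Fin n)) : Lam n k :=
  fun I => if I.1 = S then 1 else 0

/-- Exterior (wedge) product in coordinates.  When `m = k + l` this is the wedge
product `Λᵏ × Λˡ → Λ^{k+l}`; for other `m` it is `0`. -/
def wedge {n k l m : ℕ} (ω : Lam n k) (φ : Lam n l) : Lam n m :=
  fun I => ∑ R : Idx n k, ∑ S : Idx n l,
    if R.1 ∪ S.1 = I.1 ∧ Disjoint R.1 S.1 then msign R.1 S.1 * (ω R * φ S) else 0

/-- Interior product `a ⌟ b`, characterized by `⟨a ⌟ b; c⟩ = ⟨b; a ∧ c⟩`.  When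
`m = k - j` this is the interior product `Λʲ × Λᵏ → Λ^{k-j}`; for other `m` it is `0`. -/
def iprod {n j k m : ℕ} (a : Lam n j) (b : Lam n k) : Lam n m :=
  fun C => ∑ A : Idx n j, ∑ B : Idx n k,
    if A.1 ∪ C.1 = B.1 ∧ Disjoint A.1 C.1 then msign A.1 C.1 * (a A * b B) else 0

/-- Hodge star with respect to the standard orientation; when `m = n - k` this is
`∗ : Λᵏ → Λ^{n-k}`. -/
def hstar {n k m : ℕ} (ω : Lam n k) : Lam n m :=
  fun J => ∑ I : Idx n k, if I.1 = (J.1)ᶜ then msign I.1 J.1 * ω I else 0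

/-- Inner product `⟨·;·⟩` on `Λᵏ` (the basis `e^I` is orthonormal). -/
def ip {n k : ℕ} (ω α : Lam n k) : ℝ := ∑ I : Idx n k, ω I * α I

/-- `s`-fold exterior power `ω^s = ω ∧ ⋯ ∧ ω` (with `ω^0 = 1 ∈ Λ⁰`). -/
def lpow {n k : ℕ} (ω : Lam n k) : (s : ℕ) → Lam n (k * s)
  | 0 => bform ∅
  | s + 1 => wedge ω (lpow ω s)

/-- `f : Λᵏ → ℝ` is ext. one convex. -/
def ExtOneConvex {n k : ℕ} (f : Lam n k → ℝ) : Prop :=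
  ∀ (ω : Lam n k) (a : Lam n 1) (b : Lam n (k-1)),
    ConvexOn ℝ Set.univ (fun t : ℝ => f (ω + t • (wedge a b : Lam n k)))

/-- `f : Λᵏ → ℝ` is ext. one affine. -/
def ExtOneAffine {n k : ℕ} (f : Lam n k → ℝ) : Prop :=
  ExtOneConvex f ∧ ExtOneConvex (fun ω => -f ω)

/-- `f : Λᵏ → ℝ` is int. one convex. -/
def IntOneConvex {n k : ℕ} (f : Lam n k → ℝ) : Prop :=
  ∀ (ω : Lam n k) (a : Lam n 1) (b : Lam n (k+1)),
    ConvexOn ℝ Set.univ (fun t : ℝ => f (ω + t • (iprod a b : Lam n k)))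

/-- `f : Λᵏ → ℝ` is int. one affine. -/
def IntOneAffine {n k : ℕ} (f : Lam n k → ℝ) : Prop :=
  IntOneConvex f ∧ IntOneConvex (fun ω => -f ω)

/-- `f : Λ^{k+1} × Λ^{k-1} → ℝ` is ext-int. one convex. -/
def ExtIntOneConvex {n k : ℕ} (f : Lam n (k+1) → Lam n (k-1) → ℝ) : Prop :=
  ∀ (ξ : Lam n (k+1)) (η : Lam n (k-1)) (a : Lam n 1) (b : Lam n k),
    ConvexOn ℝ Set.univ
      (fun t : ℝ => f (ξ + t • (wedge a b : Lam n (k+1))) (η + t • (iprod a b : Lam n (k-1))))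

/-- `f : Λ^{k+1} × Λ^{k-1} → ℝ` is ext-int. one affine. -/
def ExtIntOneAffine {n k : ℕ} (f : Lam n (k+1) → Lam n (k-1) → ℝ) : Prop :=
  ExtIntOneConvex f ∧ ExtIntOneConvex (fun ξ η => -f ξ η)

/-- `g : Λᵏ → ℝ` is affine, i.e. a constant plus a linear functional. -/
def AffineFn {n k : ℕ} (g : Lam n k → ℝ) : Prop :=
  ∃ (c : ℝ) (a : Lam n k), ∀ ω, g ω = c + ip a ω

lemma msign_eq_prod {n : ℕ} (R S : Finset (Fin n)) :
    msign R S = ∏ p ∈ R, ∏ q ∈ S, if q < p then (-1 : ℝ) else 1 := by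
  rw [msign, ← Finset.prod_product', ← Finset.prod_filter, Finset.prod_const]

lemma msign_mul_self {n : ℕ} (R S : Finset (Fin n)) : msign R S * msign R S = 1 := by
  rw [msign, ← mul_pow]
  norm_num

lemma msign_insert_left {n : ℕ} {i : Fin n} {S : Finset (Fin n)} (hi : i ∉ S)
    (T : Finset (Fin n)) : msign (insert i S) T = msign {i} T * msign S T := by
  simp only [msign_eq_prod, Finset.prod_insert hi, Finset.prod_singleton]

lemma msign_insert_right {n : ℕ} {j : Fin n} {T : Finset (Fin n)} (hj : j ∉ T)
    (S : Finset (Fin n)) : msign S (insert j T) = msign S {j} * msign S T := by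
  simp only [msign_eq_prod, Finset.prod_insert hj, Finset.prod_singleton, Finset.prod_mul_distrib]

lemma msign_mul_msign_swap {n : ℕ} {R S : Finset (Fin n)} (h : Disjoint R S) :
    msign R S * msign S R = (-1) ^ (R.card * S.card) := by
  rw [msign_eq_prod, msign_eq_prod, Finset.prod_comm (s := S), ← Finset.prod_mul_distrib,
    mul_comm R.card, pow_mul, ← Finset.prod_const]
  refine Finset.prod_congr rfl fun p hp => ?_
  rw [← Finset.prod_mul_distrib, ← Finset.prod_const]
  refine Finset.prod_congr rfl fun q hq => ?_
  rcases lt_or_gt_of_ne (Finset.disjoint_left.mp h hp <| · ▸ hq : p ≠ q) with hpq | hpq <;>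
    simp [hpq, hpq.not_gt]

lemma msign_swap {n : ℕ} {R S : Finset (Fin n)} (h : Disjoint R S) :
    msign S R = (-1) ^ (R.card * S.card) * msign R S := by
  rw [← msign_mul_msign_swap h]
  linear_combination -msign S R * msign_mul_self R S

lemma msign_singleton_swap {n : ℕ} {i j : Fin n} (h : i ≠ j) :
    msign {j} {i} = -msign {i} {j} := by
  simpa using msign_swap (Finset.disjoint_singleton.mpr h)

lemma msign_singleton_right {n : ℕ} {i : Fin n} {S : Finset (Fin n)} (hi : i ∉ S) :
    msign S {i} = (-1) ^ S.card * msign {i} S := by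
  simpa using msign_swap (Finset.disjoint_singleton_left.mpr hi)

/-- Exchanging `i` and `j` reverses the sign of `e^i ∧ e^S ∧ e^j ∧ e^T`. -/
lemma msign_exchange_wedge {n : ℕ} {i j : Fin n} {S T : Finset (Fin n)} (hiS : i ∉ S)
    (hjS : j ∉ S) (hiT : i ∉ T) (hjT : j ∉ T) (hij : i ≠ j) :
    msign (insert j S) (insert i T) * msign {j} S * msign {i} T =
      -(msign (insert i S) (insert j T) * msign {i} S * msign {j} T) := by
  rw [msign_insert_left hjS, msign_insert_left hiS, msign_insert_right hiT,
    msign_insert_right hiT, msign_insert_right hjT, msign_insert_right hjT,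
    msign_singleton_swap hij, msign_singleton_right hiS, msign_singleton_right hjS]
  ring

/-- The sign reversal under exchange of `i` and `j` for products of contractions. -/
lemma msign_exchange_iprod {n : ℕ} {i j : Fin n} {S T : Finset (Fin n)} (hiS : i ∉ S)
    (hjS : j ∉ S) (hiT : i ∉ T) (hjT : j ∉ T) (hij : i ≠ j) :
    msign (insert j S) (insert i T) * msign {i} (insert j S) * msign {j} (insert i T) =
      -(msign (insert i S) (insert j T) * msign {j} (insert i S) * msign {i} (insert j T)) := by
  rw [msign_insert_left hjS, msign_insert_left hiS, msign_insert_right hiT,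
    msign_insert_right hiT, msign_insert_right hjT, msign_insert_right hjT,
    msign_insert_right hjS, msign_insert_right hiS,
    msign_singleton_swap hij, msign_singleton_right hiS, msign_singleton_right hjS]
  linear_combination (-1) ^ S.card * msign S T * msign {i} {j} ^ 3 *
    (msign {i} S ^ 2 * msign_mul_self {j} T + msign_mul_self {i} S
      - msign {j} S ^ 2 * msign_mul_self {i} T - msign_mul_self {j} S)

/-- A triple sum over `R`, `i ∈ R`, `j ∉ R` vanishes if its terms are antisymmetric under
exchange of `i` and `j`. -/
lemma sum_exchange_eq_zero {n k : ℕ} (F : Finset (Fin n) → Fin n → Fin n → ℝ)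
    (hF : ∀ S i j, i ∉ S → j ∉ S → i ≠ j → F (insert j S) j i = -F (insert i S) i j) :
    ∑ R : Idx n k, ∑ i ∈ R.1, ∑ j ∈ R.1ᶜ, F R.1 i j = 0 := by
  have hsub : ∑ R : Idx n k, ∑ i ∈ R.1, ∑ j ∈ R.1ᶜ, F R.1 i j =
      ∑ R ∈ Finset.univ.filter (fun R : Finset (Fin n) => R.card = k),
        ∑ i ∈ R, ∑ j ∈ Rᶜ, F R i j :=
    (Finset.sum_subtype _ (by simp) fun R => ∑ i ∈ R, ∑ j ∈ Rᶜ, F R i j).symm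
  simp_rw [hsub, ← Finset.sum_product']
  rw [Finset.sum_sigma']
  refine Finset.sum_involution
    (fun x _ => ⟨insert x.2.2 (x.1.erase x.2.1), x.2.2, x.2.1⟩) ?_ ?_ ?_ ?_
  all_goals
    rintro ⟨R, i, j⟩ hx
    simp only [Finset.mem_sigma, Finset.mem_filter, Finset.mem_univ, true_and,
      Finset.mem_product, Finset.mem_compl] at hx
    obtain ⟨hR, hi, hj⟩ := hx
    have hij : i ≠ j := fun h => hj (h ▸ hi)
    have hjS : j ∉ R.erase i := fun h => hj (Finset.mem_of_mem_erase h)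
  · have := hF (R.erase i) i j (Finset.notMem_erase i R) hjS hij
    rw [Finset.insert_erase hi] at this
    simp [this]
  · intro _ h
    simp only [Sigma.mk.injEq, heq_eq_eq, Prod.mk.injEq] at h
    exact hij h.2.2
  · have := Finset.card_erase_add_one hi
    simp [Finset.card_insert_of_notMem hjS, hij, this, hR]
  · simp [Finset.erase_insert hjS, Finset.insert_erase hi]

/-- The coefficients of a form, extended by zero to all finsets. -/
def coeff {n k : ℕ} (ω : Lam n k) (S : Finset (Fin n)) : ℝ :=
  if h : S.card = k then ω ⟨S, h⟩ else 0

lemma sum_idx_ite_eq {n k : ℕ} (ω : Lam n k) (c d : ℝ) (T : Finset (Fin n)) :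
    (∑ S : Idx n k, if S.1 = T then c * (d * ω S) else 0) = c * (d * coeff ω T) := by
  by_cases h : T.card = k
  · rw [Finset.sum_eq_single ⟨T, h⟩]
    · simp [coeff, h]
    · intro S _ hS
      rw [if_neg fun h' => hS (Subtype.ext h')]
    · simp
  · rw [Finset.sum_eq_zero]
    · simp [coeff, h]
    · rintro ⟨S, hS⟩ _
      rw [if_neg]
      rintro rfl
      exact h hS

lemma sum_idx_one {n : ℕ} (g : Idx n 1 → ℝ) :
    ∑ A, g A = ∑ i : Fin n, g ⟨{i}, Finset.card_singleton i⟩ := by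
  refine (Fintype.sum_bijective (fun i : Fin n => (⟨{i}, Finset.card_singleton i⟩ : Idx n 1))
    ⟨fun i j h => ?_, ?_⟩ _ _ fun _ => rfl).symm
  · simpa using h
  · rintro ⟨A, hA⟩
    obtain ⟨i, rfl⟩ := Finset.card_eq_one.mp hA
    exact ⟨i, rfl⟩

lemma wedge_apply {n k l m : ℕ} (ω : Lam n k) (φ : Lam n l) (I : Idx n m) :
    wedge ω φ I = ∑ R : Idx n k,
      if R.1 ⊆ I.1 then msign R.1 (I.1 \ R.1) * (ω R * coeff φ (I.1 \ R.1)) else 0 := by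
  refine Finset.sum_congr rfl fun R _ => ?_
  have key (S : Finset (Fin n)) :
      (R.1 ∪ S = I.1 ∧ Disjoint R.1 S) ↔ R.1 ⊆ I.1 ∧ S = I.1 \ R.1 := by
    constructor
    · rintro ⟨h, hd⟩
      rw [← h, Finset.union_sdiff_cancel_left hd]
      exact ⟨Finset.subset_union_left, rfl⟩
    · rintro ⟨h, rfl⟩
      exact ⟨Finset.union_sdiff_of_subset h, Finset.disjoint_sdiff⟩
  split_ifs with h
  · rw [← sum_idx_ite_eq]
    refine Finset.sum_congr rfl fun S _ => ?_
    simp only [key, h, true_and]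
    split_ifs with hS
    · rw [hS]
    · rfl
  · refine Finset.sum_eq_zero fun S _ => if_neg fun hS => h ((key S.1).mp hS).1

lemma wedge_one_apply {n l m : ℕ} (a : Lam n 1) (b : Lam n l) (I : Idx n m) :
    wedge a b I = ∑ i ∈ I.1,
      msign {i} (I.1.erase i) * (coeff a {i} * coeff b (I.1.erase i)) := by
  rw [wedge_apply, sum_idx_one, ← Finset.sum_filter]
  refine Finset.sum_congr (by ext; simp) fun i _ => ?_
  simp [coeff, Finset.sdiff_singleton_eq_erase]

lemma iprod_one_apply {n l m : ℕ} (a : Lam n 1) (b : Lam n l) (C : Idx n m) :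
    iprod a b C = ∑ i ∈ C.1ᶜ,
      msign {i} C.1 * (coeff a {i} * coeff b (insert i C.1)) := by
  rw [iprod, sum_idx_one]
  rw [← Finset.sum_subset (Finset.subset_univ C.1ᶜ)]
  · refine Finset.sum_congr rfl fun i hi => ?_
    have hiC : i ∉ C.1 := by simpa using hi
    have ha : coeff a {i} = a ⟨{i}, Finset.card_singleton i⟩ := by simp [coeff]
    rw [ha, ← sum_idx_ite_eq]
    refine Finset.sum_congr rfl fun B _ => ?_
    simp [hiC, eq_comm]
  · intro i _ hi
    have hiC : i ∈ C.1 := by simpa using hi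
    simp [hiC]

/-- The complementary multi-index. -/
def Idx.compl {k : ℕ} (R : Idx (2 * k) k) : Idx (2 * k) k :=
  ⟨R.1ᶜ, by rw [Finset.card_compl, R.2, Fintype.card_fin]; omega⟩

lemma Idx.compl_val {k : ℕ} (R : Idx (2 * k) k) : R.compl.1 = R.1ᶜ := rfl

lemma Idx.compl_compl {k : ℕ} (R : Idx (2 * k) k) : R.compl.compl = R :=
  Subtype.ext (_root_.compl_compl R.1)

lemma ip_bform_univ_wedge {k : ℕ} (ω φ : Lam (2 * k) k) :
    ip (bform Finset.univ : Lam (2 * k) (2 * k)) (wedge ω φ) =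
      ∑ R : Idx (2 * k) k, msign R.1 R.1ᶜ * (ω R * φ R.compl) := by
  rw [ip, Finset.sum_eq_single ⟨Finset.univ, by simp⟩]
  · rw [wedge_apply]
    simp only [bform, Finset.subset_univ, if_true, one_mul]
    refine Finset.sum_congr rfl fun R _ => ?_
    rw [← Finset.compl_eq_univ_sdiff, coeff, dif_pos (show R.1ᶜ.card = k from R.compl.2)]
    rfl
  · intro I _ hI
    rw [bform, if_neg fun h => hI (Subtype.ext h), zero_mul]
  · simp

lemma ip_bform_univ_wedge_wedge_one {k : ℕ} (a : Lam (2 * k) 1) (b : Lam (2 * k) (k - 1)) :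
    ip (bform Finset.univ : Lam (2 * k) (2 * k))
      (wedge (wedge a b : Lam (2 * k) k) (wedge a b : Lam (2 * k) k)) = 0 := by
  simp_rw [ip_bform_univ_wedge, wedge_one_apply, Idx.compl_val, Finset.sum_mul_sum,
    Finset.mul_sum]
  refine sum_exchange_eq_zero (fun R i j => msign R Rᶜ *
    (msign {i} (R.erase i) * (coeff a {i} * coeff b (R.erase i)) *
      (msign {j} (Rᶜ.erase j) * (coeff a {j} * coeff b (Rᶜ.erase j))))) ?_
  intro S i j hi hj hij
  obtain ⟨T, hT⟩ : ∃ T, T = (insert i (insert j S))ᶜ := ⟨_, rfl⟩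
  have hiT : i ∉ T := by simp [hT]
  have hjT : j ∉ T := by simp [hT]
  have h1 : (insert i S)ᶜ = insert j T := by
    ext x
    simp only [hT, Finset.mem_compl, Finset.mem_insert]
    grind
  have h2 : (insert j S)ᶜ = insert i T := by
    ext x
    simp only [hT, Finset.mem_compl, Finset.mem_insert]
    grind
  simp only [h1, h2, Finset.erase_insert hi, Finset.erase_insert hj, Finset.erase_insert hiT,
    Finset.erase_insert hjT]
  linear_combination coeff a {i} * coeff a {j} * coeff b S * coeff b T *
    msign_exchange_wedge hi hj hiT hjT hij

lemma ip_bform_univ_wedge_iprod_one {k : ℕ} (a : Lam (2 * k) 1) (b : Lam (2 * k) (k + 1)) :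
    ip (bform Finset.univ : Lam (2 * k) (2 * k))
      (wedge (iprod a b : Lam (2 * k) k) (iprod a b : Lam (2 * k) k)) = 0 := by
  simp_rw [ip_bform_univ_wedge, iprod_one_apply, Idx.compl_val, _root_.compl_compl,
    mul_comm (∑ i ∈ _ᶜ, _), Finset.sum_mul_sum, Finset.mul_sum]
  refine sum_exchange_eq_zero (fun R i j => msign R Rᶜ *
    (msign {i} Rᶜ * (coeff a {i} * coeff b (insert i Rᶜ)) *
      (msign {j} R * (coeff a {j} * coeff b (insert j R))))) ?_
  intro S i j hi hj hij
  obtain ⟨T, hT⟩ : ∃ T, T = (insert i (insert j S))ᶜ := ⟨_, rfl⟩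
  have hiT : i ∉ T := by simp [hT]
  have hjT : j ∉ T := by simp [hT]
  have h1 : (insert i S)ᶜ = insert j T := by
    ext x
    simp only [hT, Finset.mem_compl, Finset.mem_insert]
    grind
  have h2 : (insert j S)ᶜ = insert i T := by
    ext x
    simp only [hT, Finset.mem_compl, Finset.mem_insert]
    grind
  simp only [h1, h2, Finset.insert_comm j i]
  linear_combination coeff a {i} * coeff a {j} * coeff b (insert i (insert j S)) *
    coeff b (insert i (insert j T)) * msign_exchange_iprod hi hj hiT hjT hij

/-- On a line whose direction is isotropic, the quadratic form is affine. -/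
lemma ip_bform_univ_wedge_add_smul {k : ℕ} (ω η : Lam (2 * k) k)
    (hη : ip (bform Finset.univ : Lam (2 * k) (2 * k)) (wedge η η) = 0) :
    ∃ c d : ℝ, ∀ t : ℝ, ip (bform Finset.univ : Lam (2 * k) (2 * k))
      (wedge (ω + t • η) (ω + t • η)) = c + t * d := by
  refine ⟨ip (bform Finset.univ : Lam (2 * k) (2 * k)) (wedge ω ω),
    ip (bform Finset.univ : Lam (2 * k) (2 * k)) (wedge ω η) +
      ip (bform Finset.univ : Lam (2 * k) (2 * k)) (wedge η ω), fun t => ?_⟩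
  rw [← add_zero (_ + t * _), ← mul_zero (t ^ 2), ← hη]
  simp only [ip_bform_univ_wedge, Finset.mul_sum, ← Finset.sum_add_distrib]
  refine Finset.sum_congr rfl fun R _ => ?_
  simp only [Pi.add_apply, Pi.smul_apply, smul_eq_mul]
  ring

lemma convexOn_of_forall_eq_add_mul {g : ℝ → ℝ} {c d : ℝ} (h : ∀ t, g t = c + t * d) :
    ConvexOn ℝ Set.univ g := by
  refine ⟨convex_univ, fun x _ y _ p q _ _ hpq => le_of_eq ?_⟩
  simp only [h, smul_eq_mul]
  linear_combination -c * hpq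

lemma exists_ip_bform_univ_wedge_ne_zero {k : ℕ} (hk : Even k) :
    ∃ ω : Lam (2 * k) k, ip (bform Finset.univ : Lam (2 * k) (2 * k)) (wedge ω ω) ≠ 0 := by
  obtain ⟨s, -, hs⟩ := Finset.exists_subset_card_eq
    (s := (Finset.univ : Finset (Fin (2 * k)))) (n := k) (by simp; omega)
  obtain ⟨R, hR⟩ : ∃ R : Idx (2 * k) k, R = ⟨s, hs⟩ := ⟨_, rfl⟩
  have hsymm : msign R.1ᶜ R.1 = msign R.1 R.1ᶜ := by
    rw [msign_swap (disjoint_compl_right (a := R.1)), R.2, (hk.mul_right _).neg_one_pow, one_mul]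
  obtain ⟨ω, hω⟩ : ∃ ω : Lam (2 * k) k, ω = fun P => if P = R ∨ P = R.compl then 1 else 0 :=
    ⟨_, rfl⟩
  have hpos : 0 < ∑ P : Idx (2 * k) k,
      msign R.1 R.1ᶜ * (msign P.1 P.1ᶜ * (ω P * ω P.compl)) := by
    refine Finset.sum_pos' (fun P _ => ?_) ⟨R, Finset.mem_univ R, ?_⟩
    · by_cases hP : P = R ∨ P = R.compl
      · have : msign P.1 P.1ᶜ = msign R.1 R.1ᶜ := by
          rcases hP with rfl | rfl
          · rfl
          · rw [Idx.compl_val, _root_.compl_compl, hsymm]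
        rw [this, ← mul_assoc, msign_mul_self, one_mul, hω]
        positivity
      · simp [hω, hP]
    · rw [← mul_assoc, msign_mul_self]
      simp [hω]
  refine ⟨ω, fun h => hpos.ne' ?_⟩
  rw [← Finset.mul_sum, ← ip_bform_univ_wedge, h, mul_zero]

/-- **Counterexample for `n = 2k`, `k` even.** The function
`f(ω) := ⟨e^1 ∧ ⋯ ∧ e^{2k}; ω ∧ ω⟩` on `Λᵏ(ℝ^{2k})` is both ext. one affine and
int. one affine, but not affine. -/
theorem stmt5 {k : ℕ} (hk : Even k) (f : Lam (2*k) k → ℝ)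
    (hf : ∀ ω : Lam (2*k) k, f ω = ip (bform Finset.univ : Lam (2*k) (2*k)) (wedge ω ω)) :
    ExtOneAffine f ∧ IntOneAffine f ∧
      ¬ ∃ (c : ℝ) (a : Lam (2*k) k), ∀ ω, f ω = c + ip a ω := by
  have hline (ω η : Lam (2 * k) k) (hη : f η = 0) :
      ConvexOn ℝ Set.univ (fun t : ℝ => f (ω + t • η)) ∧
        ConvexOn ℝ Set.univ (fun t : ℝ => -f (ω + t • η)) := by
    obtain ⟨c, d, h⟩ := ip_bform_univ_wedge_add_smul ω η (hf η ▸ hη)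
    simp only [← hf] at h
    exact ⟨convexOn_of_forall_eq_add_mul h,
      convexOn_of_forall_eq_add_mul (c := -c) (d := -d) fun t => by rw [h]; ring⟩
  have hext (a : Lam (2 * k) 1) (b : Lam (2 * k) (k - 1)) : f (wedge a b) = 0 := by
    rw [hf, ip_bform_univ_wedge_wedge_one]
  have hint (a : Lam (2 * k) 1) (b : Lam (2 * k) (k + 1)) : f (iprod a b) = 0 := by
    rw [hf, ip_bform_univ_wedge_iprod_one]
  refine ⟨⟨fun ω a b => (hline ω _ (hext a b)).1, fun ω a b => (hline ω _ (hext a b)).2⟩,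
    ⟨fun ω a b => (hline ω _ (hint a b)).1, fun ω a b => (hline ω _ (hint a b)).2⟩, ?_⟩
  rintro ⟨c, a, h⟩
  obtain ⟨ω, hω⟩ := exists_ip_bform_univ_wedge_ne_zero hk
  have hzero : f 0 = 0 := by simp [hf, ip_bform_univ_wedge]
  have hneg : f (-ω) = f ω := by simp [hf, ip_bform_univ_wedge]
  have ip_zero : ip a 0 = 0 := by simp [ip]
  have ip_neg : ip a (-ω) = -ip a ω := by simp [ip]
  rw [← hf] at hω
  rw [h, ip_zero] at hzero
  rw [h, h, ip_neg] at hneg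
  rw [h] at hω
  exact hω (by linarith)
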